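/- (Lemma 2, general case) Let p be an odd prime, d ≥ 2 with d ∣ p−1, f = (p−1)/d. For every 0 ≤ ν ≤ d−1 and every k ≥ 5: n(k,ν) + f^k = p · Σ_{i_2,…,i_{k−1}=0}^{d−1} (ν,i_2)(i_2,i_3)⋯(i_{k−1},θ) + f·δ_{θ0}·[n(k−2,ν) + f^{k−2}] + f·(0,θ)·[n(k−3,ν) + f^{k−3}] + Σ_{j=4}^{k−1} f · [ Σ_{i_2,…,i_{j−2}=0}^{d−1} (0,i_2)⋯(i_{j−2},θ) ] · [n(k−j,ν) + f^{k−j}], where for j = 4 the inner bracket is the single number (0,θ) replaced by the empty-chain convention, i.e. the chain of length j−2 of cyclotomic numbers starting at 0 and ending at θ. -/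

import Mathlib

open Finset

/-- The Gauss period `η_i = Σ_{u=0}^{f-1} ζ^{ω^{du+i}}`. -/
noncomputable def gaussPeriod (p d f : ℕ) (ω : (ZMod p)ˣ) (ζ : ℂ) (i : ℕ) : ℂ :=
  ∑ u ∈ Finset.range f, ζ ^ (((ω : ZMod p) ^ (d * u + i)).val)

/-- The cyclotomic number `(i,j)` of order `d`. -/
noncomputable def cycNum (p d f : ℕ) (ω : (ZMod p)ˣ) (i j : ℕ) : ℕ :=
  Nat.card {uv : ℕ × ℕ // uv.1 < f ∧ uv.2 < f ∧
    (1 : ZMod p) + (ω : ZMod p) ^ (d * uv.1 + i) = (ω : ZMod p) ^ (d * uv.2 + j)}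

/-- The cyclotomic integer `n(k,ν) = Σ_{i=0}^{d-1} η_i^k · η_{i+ν}`. -/
noncomputable def nInt (p d f : ℕ) (ω : (ZMod p)ˣ) (ζ : ℂ) (k ν : ℕ) : ℂ :=
  ∑ i ∈ Finset.range d, (gaussPeriod p d f ω ζ i) ^ k * gaussPeriod p d f ω ζ (i + ν)

/-- `θ = 0` if `f` is even, `θ = d/2` if `f` is odd. -/
def theta (d f : ℕ) : ℕ := if Even f then 0 else d / 2

/-- `N(k,a)`: the number of `k`-tuples of nonzero `d`-th powers summing to `a`. -/
noncomputable def waringCount (p d k : ℕ) (a : ZMod p) : ℕ :=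
  Nat.card {t : Fin k → ZMod p //
    (∀ i, ∃ b : (ZMod p)ˣ, ((b : ZMod p)) ^ d = t i) ∧ ∑ i, t i = a}

/-- `s_d(p,a)`: the least `k ≥ 1` such that `a` is a sum of `k` nonzero `d`-th powers. -/
noncomputable def sWaring (p d : ℕ) (a : ZMod p) : ℕ :=
  sInf {k | 1 ≤ k ∧ ∃ u : Fin k → (ZMod p)ˣ, a = ∑ i, ((u i : ZMod p)) ^ d}

/-- `g_d(p) = max_{a ∈ 𝔽_p^*} s_d(p,a)`. -/
noncomputable def gWaring (p d : ℕ) : ℕ :=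
  sSup {s | ∃ a : (ZMod p)ˣ, s = sWaring p d (a : ZMod p)}

/-- Product of a chain of cyclotomic numbers `(a,x₁)(x₁,x₂)⋯(xₘ,b)`. -/
noncomputable def chainProd (c : ℕ → ℕ → ℕ) (a b : ℕ) : List ℕ → ℕ
  | [] => c a b
  | x :: xs => c a x * chainProd c x b xs

/-- Sum over all chains of `m` intermediate indices `0 ≤ i < d` of the products
`(a,i₂)(i₂,i₃)⋯(i_{m+1},b)` of consecutive cyclotomic numbers. -/
noncomputable def chainSum (d : ℕ) (c : ℕ → ℕ → ℕ) (a b m : ℕ) : ℕ :=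
  ∑ v : Fin m → Fin d, chainProd c a b (List.ofFn fun i => ((v i : ℕ)))

section aux

/-- Period sum attached to an arbitrary additive character. -/
noncomputable def perSum (p d f : ℕ) (ω : (ZMod p)ˣ) (ψ : AddChar (ZMod p) ℂ) (i : ℕ) : ℂ :=
  ∑ u ∈ Finset.range f, ψ ((ω : ZMod p) ^ (d * u + i))

lemma sum_shift (f w : ℕ) (F : ℕ → ℂ) (hF : ∀ n, F (n + f) = F n) :
    ∑ u ∈ range f, F (u + w) = ∑ u ∈ range f, F u := by
  induction w with
  | zero => simp
  | succ w ih =>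
    rw [← ih]
    have h1 := Finset.sum_range_succ (fun u => F (u + w)) f
    have h2 := Finset.sum_range_succ' (fun u => F (u + w)) f
    have h3 : F (f + w) = F (0 + w) := by rw [add_comm f w, hF, zero_add]
    have h4 : ∑ u ∈ range f, F (u + (w + 1)) = ∑ u ∈ range f, F (u + 1 + w) := by
      refine Finset.sum_congr rfl fun u _ => ?_
      congr 1; ring
    rw [h4]
    rw [h3] at h1
    exact add_right_cancel (h2.symm.trans h1)

lemma chainSum_zero (d : ℕ) (c : ℕ → ℕ → ℕ) (a b : ℕ) : chainSum d c a b 0 = c a b := by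
  simp [chainSum, chainProd]

lemma chainSum_succ (d : ℕ) (c : ℕ → ℕ → ℕ) (a b m : ℕ) :
    chainSum d c a b (m + 1) = ∑ x ∈ range d, c a x * chainSum d c x b m := by
  unfold chainSum
  rw [← (Fin.consEquiv (fun _ : Fin (m + 1) => Fin d)).sum_comp, Fintype.sum_prod_type,
    Finset.sum_range]
  refine Finset.sum_congr rfl fun x _ => ?_
  rw [Finset.mul_sum]
  refine Finset.sum_congr rfl fun v _ => ?_
  simp [Fin.consEquiv, List.ofFn_succ, chainProd]

variable {p d f : ℕ} {ω : (ZMod p)ˣ}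

lemma order_eq (hp : p.Prime) (hω : ∀ x : (ZMod p)ˣ, ∃ n : ℕ, ω ^ n = x) :
    orderOf ω = p - 1 := by
  have := Fact.mk hp
  rw [orderOf_eq_card_of_forall_mem_zpowers (g := ω), Nat.card_eq_fintype_card, ZMod.card_units]
  intro x
  obtain ⟨n, hn⟩ := hω x
  exact ⟨n, by simpa using hn⟩

lemma pow_inj (hp : p.Prime) (hω : ∀ x : (ZMod p)ˣ, ∃ n : ℕ, ω ^ n = x)
    {a b : ℕ} (ha : a < p - 1) (hb : b < p - 1)
    (h : (ω : ZMod p) ^ a = (ω : ZMod p) ^ b) : a = b := by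
  rw [← order_eq hp hω] at ha hb
  refine pow_injOn_Iio_orderOf ha hb ?_
  simp only
  ext
  simpa using h

lemma lt_bound {d f j v : ℕ} (hj : j < d) (hv : v < f) : d * v + j < d * f := by
  have : d * (v + 1) ≤ d * f := Nat.mul_le_mul_left d hv
  rw [Nat.mul_add] at this
  omega

lemma split_unique {d j j' v v' : ℕ} (hj : j < d) (hj' : j' < d)
    (h : d * v + j = d * v' + j') : v = v' ∧ j = j' := by
  have hd : 0 < d := by omega
  have h1 : (d * v + j) / d = v := by
    rw [Nat.mul_add_div hd, Nat.div_eq_of_lt hj]; rfl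
  have h2 : (d * v' + j') / d = v' := by
    rw [Nat.mul_add_div hd, Nat.div_eq_of_lt hj']; rfl
  have h3 : v = v' := by rw [← h1, h, h2]
  subst h3
  exact ⟨rfl, by omega⟩

lemma rep_one (hp : p.Prime) (hd : 0 < d) (hdf : d * f = p - 1)
    (hω : ∀ x : (ZMod p)ˣ, ∃ n : ℕ, ω ^ n = x) (x : ZMod p) :
    ∑ j ∈ range d, ∑ v ∈ range f, (if x = (ω : ZMod p) ^ (d * v + j) then (1 : ℂ) else 0)
      + (if x = 0 then 1 else 0) = 1 := by
  have := Fact.mk hp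
  by_cases hx : x = 0
  · subst hx
    have : ∀ n : ℕ, ¬ ((0 : ZMod p) = (ω : ZMod p) ^ n) := fun n h =>
      (pow_ne_zero n ω.ne_zero) h.symm
    simp [this]
  · obtain ⟨n, hn⟩ := hω (Units.mk0 x hx)
    set m := n % (p - 1) with hm
    have hp1 : 0 < p - 1 := by have := hp.two_le; omega
    have hmlt : m < p - 1 := Nat.mod_lt _ hp1
    have hxm : x = (ω : ZMod p) ^ m := by
      have h1 : ω ^ m = ω ^ n := by rw [hm, ← order_eq hp hω, pow_mod_orderOf]
      have := congrArg (fun y : (ZMod p)ˣ => (y : ZMod p)) (h1.trans hn)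
      simpa using this.symm
    have hmv : m / d < f := by
      rw [Nat.div_lt_iff_lt_mul hd, mul_comm, hdf]; exact hmlt
    rw [if_neg hx, add_zero, Finset.sum_eq_single (m % d)]
    · rw [Finset.sum_eq_single (m / d)]
      · rw [Nat.div_add_mod, if_pos hxm]
      · intro v hv hne
        rw [if_neg]
        intro h
        rw [hxm] at h
        have hb := lt_bound (Nat.mod_lt m hd) (mem_range.1 hv)
        have h2 := pow_inj hp hω hmlt (by omega) h
        have h3 : d * (m / d) + m % d = d * v + m % d := by rw [Nat.div_add_mod]; exact h2
        exact hne (split_unique (Nat.mod_lt m hd) (Nat.mod_lt m hd) h3).1.symm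
      · intro h; exact absurd (mem_range.2 hmv) h
    · intro j hj hne
      refine Finset.sum_eq_zero fun v hv => ?_
      rw [if_neg]
      intro h
      rw [hxm] at h
      have hb := lt_bound (mem_range.1 hj) (mem_range.1 hv)
      have h2 := pow_inj hp hω hmlt (by omega) h
      have h3 : d * (m / d) + m % d = d * v + j := by rw [Nat.div_add_mod]; exact h2
      exact hne (split_unique (Nat.mod_lt m hd) (mem_range.1 hj) h3).2.symm
    · intro h; exact absurd (mem_range.2 (Nat.mod_lt m hd)) h

lemma pow_period (hp : p.Prime) (hdf : d * f = p - 1)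
    (hω : ∀ x : (ZMod p)ˣ, ∃ n : ℕ, ω ^ n = x) : (ω : ZMod p) ^ (d * f) = 1 := by
  have : ω ^ (d * f) = 1 := by rw [hdf, ← order_eq hp hω, pow_orderOf_eq_one]
  simpa using congrArg (fun y : (ZMod p)ˣ => (y : ZMod p)) this

lemma cycNum_cast (i j : ℕ) : (cycNum p d f ω i j : ℂ) =
    ∑ u ∈ range f, ∑ v ∈ range f,
      (if (1 : ZMod p) + (ω : ZMod p) ^ (d * u + i) = (ω : ZMod p) ^ (d * v + j)
        then (1 : ℂ) else 0) := by
  classical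
  have : cycNum p d f ω i j = #{uv ∈ range f ×ˢ range f |
      (1 : ZMod p) + (ω : ZMod p) ^ (d * uv.1 + i) = (ω : ZMod p) ^ (d * uv.2 + j)} := by
    unfold cycNum
    apply Nat.subtype_card
    intro x
    simp [and_assoc]
  rw [this, Finset.card_filter, Finset.sum_product]
  push_cast
  rfl

lemma neg_one_count (hp : p.Prime) (hodd : Odd p) (hd : 2 ≤ d) (hdf : d * f = p - 1)
    (hω : ∀ x : (ZMod p)ˣ, ∃ n : ℕ, ω ^ n = x) (ν : ℕ) (hν : ν < d) :
    ∑ w ∈ range f, (if (1 : ZMod p) + (ω : ZMod p) ^ (d * w + ν) = 0 then (1 : ℂ) else 0)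
      = if ν = theta d f then 1 else 0 := by
  have := Fact.mk hp
  have hp2 := hp.two_le
  have hf0 : 0 < f := by
    rcases Nat.eq_zero_or_pos f with h | h
    · subst h; omega
    · exact h
  have hp3 : p ≠ 2 := by rintro rfl; exact absurd hodd (by decide)
  obtain ⟨w0, hw0, hθ, hM⟩ : ∃ w0, w0 < f ∧ theta d f < d ∧ 2 * (d * w0 + theta d f) = p - 1 := by
    unfold theta
    split_ifs with he
    · obtain ⟨e, he⟩ := he
      exact ⟨e, by omega, by omega, by rw [← hdf, he]; ring⟩
    · rw [Nat.not_even_iff_odd] at he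
      have hev : Even (d * f) := by
        rw [hdf]; obtain ⟨t, ht⟩ := hodd; exact ⟨t, by omega⟩
      have hde : Even d := by
        rcases Nat.even_mul.1 hev with h | h
        · exact h
        · exact absurd h (Nat.not_even_iff_odd.2 he)
      obtain ⟨t, ht⟩ := hde
      obtain ⟨e, he⟩ := he
      have h2 : d / 2 = t := by omega
      refine ⟨e, by omega, by omega, ?_⟩
      rw [← hdf, he, h2, ht]; ring
  have hlt : d * w0 + theta d f < p - 1 := by omega
  have hneg : (ω : ZMod p) ^ (d * w0 + theta d f) = -1 := by
    have hsq : ((ω : ZMod p) ^ (d * w0 + theta d f)) ^ 2 = 1 := by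
      rw [← pow_mul, mul_comm, hM, ← hdf, pow_period hp hdf hω]
    rcases (mul_self_eq_one_iff.1 ((sq _).symm.trans hsq)) with h | h
    · exfalso
      have := pow_inj hp hω hlt (b := 0) (by omega) (by simpa using h)
      omega
    · exact h
  have key : ∀ w ∈ range f, ((1 : ZMod p) + (ω : ZMod p) ^ (d * w + ν) = 0 ↔
      (w = w0 ∧ ν = theta d f)) := by
    intro w hw
    constructor
    · intro h
      have h1 : (ω : ZMod p) ^ (d * w + ν) = (ω : ZMod p) ^ (d * w0 + theta d f) := by
        rw [hneg]; linear_combination h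
      have hb := lt_bound hν (mem_range.1 hw)
      exact split_unique hν hθ (pow_inj hp hω (by omega) hlt h1)
    · rintro ⟨rfl, rfl⟩
      rw [hneg]; ring
  rw [Finset.sum_congr rfl fun w hw => if_congr (key w hw) rfl rfl]
  by_cases h : ν = theta d f
  · simp [h, hw0]
  · simp [h]

lemma perSum_prod (hp : p.Prime) (hodd : Odd p) (hd : 2 ≤ d) (hdf : d * f = p - 1)
    (hω : ∀ x : (ZMod p)ˣ, ∃ n : ℕ, ω ^ n = x) (ψ : AddChar (ZMod p) ℂ)
    (i ν : ℕ) (hν : ν < d) :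
    perSum p d f ω ψ i * perSum p d f ω ψ (i + ν)
      = ∑ j ∈ range d, (cycNum p d f ω ν j : ℂ) * perSum p d f ω ψ (i + j)
        + (f : ℂ) * (if ν = theta d f then 1 else 0) := by
  have hper := pow_period hp hdf hω
  -- the twisted sum
  let T : ZMod p → ℂ := fun x => ∑ u ∈ range f, ψ ((ω : ZMod p) ^ (d * u + i) * x)
  have hT0 : T 0 = f := by simp [T]
  have hTp : ∀ v j, T ((ω : ZMod p) ^ (d * v + j)) = perSum p d f ω ψ (i + j) := by
    intro v j
    have := sum_shift f v (fun u => ψ ((ω : ZMod p) ^ (d * u + (i + j)))) (by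
      intro n
      rw [show d * (n + f) + (i + j) = d * n + (i + j) + d * f by ring, pow_add _ _ (d * f), hper,
        mul_one])
    unfold perSum
    rw [← this]
    refine Finset.sum_congr rfl fun u _ => ?_
    rw [← pow_add]
    congr 2; ring
  have hT : ∀ x, T x = ∑ j ∈ range d, ∑ v ∈ range f,
      (if x = (ω : ZMod p) ^ (d * v + j) then (1 : ℂ) else 0) * perSum p d f ω ψ (i + j)
      + f * (if x = 0 then 1 else 0) := by
    intro x
    have h1 := rep_one (f := f) hp (by omega) hdf hω x
    calc T x = (∑ j ∈ range d, ∑ v ∈ range f,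
          (if x = (ω : ZMod p) ^ (d * v + j) then (1 : ℂ) else 0)
          + (if x = 0 then 1 else 0)) * T x := by rw [h1, one_mul]
      _ = _ := by
        rw [add_mul, Finset.sum_mul]
        congr 1
        · refine Finset.sum_congr rfl fun j _ => ?_
          rw [Finset.sum_mul]
          refine Finset.sum_congr rfl fun v _ => ?_
          split_ifs with h
          · rw [h, hTp]
          · simp
        · split_ifs with h
          · rw [h, hT0]; ring
          · simp
  have hLHS : perSum p d f ω ψ i * perSum p d f ω ψ (i + ν)
      = ∑ w ∈ range f, T (1 + (ω : ZMod p) ^ (d * w + ν)) := by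
    simp only [T]
    rw [Finset.sum_comm]
    rw [perSum, Finset.sum_mul]
    refine Finset.sum_congr rfl fun u _ => ?_
    have := sum_shift f u (fun v => ψ ((ω : ZMod p) ^ (d * v + (i + ν)))) (by
      intro n
      rw [show d * (n + f) + (i + ν) = d * n + (i + ν) + d * f by ring, pow_add _ _ (d * f), hper,
        mul_one])
    unfold perSum
    rw [← this, Finset.mul_sum]
    refine Finset.sum_congr rfl fun w _ => ?_
    rw [← AddChar.map_add_eq_mul]
    congr 1
    ring
  rw [hLHS, Finset.sum_congr rfl fun w _ => hT _, Finset.sum_add_distrib, ← Finset.mul_sum,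
    neg_one_count hp hodd hd hdf hω ν hν, Finset.sum_comm]
  congr 1
  refine Finset.sum_congr rfl fun j _ => ?_
  rw [cycNum_cast, Finset.sum_mul]
  refine Finset.sum_congr rfl fun u _ => ?_
  rw [Finset.sum_mul]

lemma perSum_period (hp : p.Prime) (hdf : d * f = p - 1)
    (hω : ∀ x : (ZMod p)ˣ, ∃ n : ℕ, ω ^ n = x) (ψ : AddChar (ZMod p) ℂ) (i : ℕ) :
    perSum p d f ω ψ (i + d) = perSum p d f ω ψ i := by
  have := sum_shift f 1 (fun u => ψ ((ω : ZMod p) ^ (d * u + i))) (by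
      intro n
      rw [show d * (n + f) + i = d * n + i + d * f by ring, pow_add _ _ (d * f),
        pow_period hp hdf hω, mul_one])
  unfold perSum
  rw [← this]
  refine Finset.sum_congr rfl fun u _ => ?_
  congr 2; ring

lemma perSum_total (hp : p.Prime) (hd : 0 < d) (hdf : d * f = p - 1)
    (hω : ∀ x : (ZMod p)ˣ, ∃ n : ℕ, ω ^ n = x) (ψ : AddChar (ZMod p) ℂ) (hψ : ψ ≠ 1) :
    ∑ i ∈ range d, perSum p d f ω ψ i = -1 := by
  have := Fact.mk hp
  have h0 : ∑ x : ZMod p, ψ x = 0 := AddChar.sum_eq_zero_of_ne_one hψ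
  have h1 : ∑ x : ZMod p, ψ x = ∑ x : ZMod p, (∑ j ∈ range d, ∑ v ∈ range f,
      (if x = (ω : ZMod p) ^ (d * v + j) then (1 : ℂ) else 0)
      + (if x = 0 then 1 else 0)) * ψ x := by
    refine Finset.sum_congr rfl fun x _ => ?_
    rw [rep_one (f := f) hp hd hdf hω x, one_mul]
  have h2 : ∑ x : ZMod p, (∑ j ∈ range d, ∑ v ∈ range f,
      (if x = (ω : ZMod p) ^ (d * v + j) then (1 : ℂ) else 0)
      + (if x = 0 then 1 else 0)) * ψ x = ∑ i ∈ range d, perSum p d f ω ψ i + 1 := by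
    simp only [add_mul, Finset.sum_add_distrib, Finset.sum_mul]
    congr 1
    · rw [Finset.sum_comm]
      refine Finset.sum_congr rfl fun j _ => ?_
      rw [Finset.sum_comm]
      refine Finset.sum_congr rfl fun v _ => ?_
      simp
    · simp
  rw [h0, h2] at h1
  linear_combination -h1

end aux

/-- Pure algebra: from the transfer recursion to the convolution identity. -/
lemma conv_identity (d : ℕ) (P F : ℂ) (c : ℕ → ℕ → ℂ) (N g : ℕ → ℕ → ℂ)
    (hd : 0 < d)
    (hg : ∀ m a, g (m + 1) a = ∑ j ∈ range d, c a j * g m j)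
    (hN0 : ∀ a < d, N 0 a = 0)
    (hN1 : ∀ a < d, N 1 a = P * g 0 a)
    (hN : ∀ k, ∀ a < d, N (k + 2) a
      = ∑ j ∈ range d, c a j * N (k + 1) j + F * g 0 a * N k 0)
    (k ν : ℕ) (hν : ν < d) :
    N (k + 2) ν = P * g (k + 1) ν + ∑ i ∈ range (k + 1), F * g i 0 * N (k - i) ν := by
  have A : ∀ k, ∀ a < d, N (k + 1) a
      = P * g k a + ∑ i ∈ range k, F * g i a * N (k - 1 - i) 0 := by
    intro k
    induction k with
    | zero => intro a ha; simp [hN1 a ha]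
    | succ k ih =>
      intro a ha
      rw [hN k a ha, Finset.sum_range_succ', hg k a]
      have : ∑ j ∈ range d, c a j * N (k + 1) j
          = P * ∑ j ∈ range d, c a j * g k j
            + ∑ i ∈ range k, F * g (i + 1) a * N (k + 1 - 1 - (i + 1)) 0 := by
        rw [Finset.sum_congr rfl fun j hj => by rw [ih j (mem_range.1 hj)]]
        simp only [mul_add, Finset.sum_add_distrib, Finset.mul_sum]
        congr 1
        · refine Finset.sum_congr rfl fun j _ => by ring
        · rw [Finset.sum_comm]
          refine Finset.sum_congr rfl fun i _ => ?_
          rw [hg, Finset.mul_sum, Finset.sum_mul]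
          refine Finset.sum_congr rfl fun j _ => ?_
          rw [show k + 1 - 1 - (i + 1) = k - 1 - i by omega]
          ring
      rw [this]
      simp
      ring
  -- generating functions
  let Aser : ℕ → PowerSeries ℂ := fun a => PowerSeries.mk fun k => N k a
  let G : ℕ → PowerSeries ℂ := fun a => PowerSeries.mk fun k => g k a
  have coeffprod : ∀ (a b n : ℕ), PowerSeries.coeff n (G a * Aser b)
      = ∑ i ∈ range (n + 1), g i a * N (n - i) b := by
    intro a b n
    rw [PowerSeries.coeff_mul, Finset.Nat.sum_antidiagonal_eq_sum_range_succ_mk]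
    simp [Aser, G]
  have E : ∀ a < d, Aser a = PowerSeries.X * (PowerSeries.C P * G a)
      + PowerSeries.X * (PowerSeries.X * (PowerSeries.C F * (G a * Aser 0))) := by
    intro a ha
    ext n
    rcases n with _ | _ | n
    · simp [Aser, hN0 a ha]
    · rw [map_add, PowerSeries.coeff_succ_X_mul, PowerSeries.coeff_succ_X_mul]
      simp [Aser, G, hN1 a ha]
    · rw [map_add, PowerSeries.coeff_succ_X_mul, PowerSeries.coeff_succ_X_mul,
        PowerSeries.coeff_succ_X_mul, PowerSeries.coeff_C_mul, PowerSeries.coeff_C_mul, coeffprod]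
      simp only [Aser, G, PowerSeries.coeff_mk]
      rw [A (n + 1) a ha, Finset.mul_sum]
      congr 1
      refine Finset.sum_congr rfl fun i _ => ?_
      rw [Nat.add_sub_cancel]; ring
  have hE : Aser ν = PowerSeries.X * (PowerSeries.C P * G ν)
      + PowerSeries.X * (PowerSeries.X * (PowerSeries.C F * (G 0 * Aser ν))) := by
    linear_combination
      (1 - PowerSeries.X * PowerSeries.X * PowerSeries.C F * G 0) * E ν hν
      + PowerSeries.X * PowerSeries.X * PowerSeries.C F * G ν * E 0 hd
  have h := congrArg (PowerSeries.coeff (k + 2)) hE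
  rw [map_add, PowerSeries.coeff_succ_X_mul, PowerSeries.coeff_succ_X_mul,
    PowerSeries.coeff_succ_X_mul, PowerSeries.coeff_C_mul, PowerSeries.coeff_C_mul, coeffprod] at h
  simp only [Aser, G, PowerSeries.coeff_mk] at h
  rw [h, Finset.mul_sum]
  congr 1
  refine Finset.sum_congr rfl fun i _ => by ring

/-- Lemma 2, general case `k ≥ 5`:
`n(k,ν) + f^k = p·Σ_{i₂,…,i_{k-1}}(ν,i₂)(i₂,i₃)⋯(i_{k-1},θ) + f·δ_{θ0}·[n(k−2,ν)+f^{k−2}]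
+ f·(0,θ)·[n(k−3,ν)+f^{k−3}] + Σ_{j=4}^{k-1} f·[Σ_{i₂,…,i_{j-2}}(0,i₂)⋯(i_{j-2},θ)]·[n(k−j,ν)+f^{k−j}]`. -/
theorem nInt_general (p d f : ℕ) (hp : p.Prime) (hodd : Odd p)
    (hd : 2 ≤ d) (hdvd : d ∣ p - 1) (hf : f = (p - 1) / d)
    (ω : (ZMod p)ˣ) (hω : ∀ x : (ZMod p)ˣ, ∃ n : ℕ, ω ^ n = x)
    (ζ : ℂ) (hζ : IsPrimitiveRoot ζ p)
    (ν : ℕ) (hν : ν < d) (k : ℕ) (hk : 5 ≤ k) :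
    nInt p d f ω ζ k ν + (f : ℂ) ^ k
      = (p : ℂ) * (chainSum d (cycNum p d f ω) ν (theta d f) (k - 2) : ℂ)
        + (f : ℂ) * (if theta d f = 0 then 1 else 0)
            * (nInt p d f ω ζ (k - 2) ν + (f : ℂ) ^ (k - 2))
        + (f : ℂ) * (cycNum p d f ω 0 (theta d f) : ℂ)
            * (nInt p d f ω ζ (k - 3) ν + (f : ℂ) ^ (k - 3))
        + ∑ j ∈ Finset.Icc 4 (k - 1),
            (f : ℂ) * (chainSum d (cycNum p d f ω) 0 (theta d f) (j - 3) : ℂ)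
              * (nInt p d f ω ζ (k - j) ν + (f : ℂ) ^ (k - j)) := by
  have := Fact.mk hp
  have hdf : d * f = p - 1 := by rw [hf]; exact Nat.mul_div_cancel' hdvd
  have hp2 := hp.two_le
  have hf0 : (f : ℂ) ≠ 0 := by
    have : f ≠ 0 := by rintro h; rw [h] at hdf; omega
    exact_mod_cast this
  set θ := theta d f with hθ
  have hθd : θ < d := by rw [hθ]; unfold theta; split_ifs <;> omega
  let ψ : AddChar (ZMod p) ℂ := AddChar.zmodChar p hζ.pow_eq_one
  have hψ : ψ ≠ 1 := by
    intro h
    have h1 : ψ 1 = 1 := by rw [h]; rfl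
    rw [AddChar.zmodChar_apply] at h1
    have := Fact.mk hp.one_lt
    rw [ZMod.val_one, pow_one] at h1
    exact hζ.ne_one hp.one_lt h1
  have hgp : ∀ i, gaussPeriod p d f ω ζ i = perSum p d f ω ψ i := fun i => rfl
  set η := perSum p d f ω ψ with hη
  have hn : ∀ k ν, nInt p d f ω ζ k ν = ∑ i ∈ range d, η i ^ k * η (i + ν) := fun k ν => rfl
  -- row sums
  have hrow : ∀ a < d, ∑ j ∈ range d, (cycNum p d f ω a j : ℂ)
      = f - (if a = θ then 1 else 0) := by
    intro a ha
    have h := perSum_prod hp hodd hd hdf hω (1 : AddChar (ZMod p) ℂ) 0 a ha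
    have h1 : ∀ i, perSum p d f ω (1 : AddChar (ZMod p) ℂ) i = f := by
      intro i; simp [perSum]
    simp only [h1, ← Finset.sum_mul] at h
    apply mul_right_cancel₀ hf0
    linear_combination -h
  have hprod := fun i a ha => perSum_prod hp hodd hd hdf hω ψ i a ha
  rw [← hη, ← hθ] at hprod
  have htot : ∀ a, ∑ i ∈ range d, η (i + a) = -1 := by
    intro a
    rw [sum_shift d a η (perSum_period hp hdf hω ψ)]
    exact perSum_total hp (by omega) hdf hω ψ hψ
  let N : ℕ → ℕ → ℂ := fun k a => nInt p d f ω ζ k a + (f : ℂ) ^ k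
  let g : ℕ → ℕ → ℂ := fun m a => match m with
    | 0 => if a = θ then 1 else 0
    | m + 1 => (chainSum d (cycNum p d f ω) a θ m : ℂ)
  have hrec : ∀ k, ∀ a < d, nInt p d f ω ζ (k + 1) a
      = ∑ j ∈ range d, (cycNum p d f ω a j : ℂ) * nInt p d f ω ζ k j
        + f * (if a = θ then 1 else 0) * ∑ i ∈ range d, η i ^ k := by
    intro k a ha
    simp only [hn, Finset.mul_sum]
    rw [Finset.sum_comm, ← Finset.sum_add_distrib]
    refine Finset.sum_congr rfl fun i _ => ?_
    rw [pow_succ, mul_assoc, hprod i a ha, mul_add, Finset.mul_sum]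
    congr 1
    · refine Finset.sum_congr rfl fun j _ => by ring
    · ring
  have hn0 : ∀ a, nInt p d f ω ζ 0 a = -1 := by
    intro a
    simp only [hn, pow_zero, one_mul]
    exact htot a
  have hpc : (p : ℂ) = d * f + 1 := by
    have : p = d * f + 1 := by omega
    exact_mod_cast this
  have main := conv_identity d (p : ℂ) (f : ℂ) (fun a j => (cycNum p d f ω a j : ℂ)) N g
    (by omega)
    (by
      intro m a
      rcases m with _ | m
      · simp [g, chainSum_zero, hθd]
      · simp [g, chainSum_succ])
    (by intro a _; simp [N, hn0])
    (by
      intro a ha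
      simp only [N, g]
      rw [hrec 0 a ha]
      simp only [hn0, mul_neg, mul_one, pow_zero, Finset.sum_neg_distrib, hrow a ha,
        Finset.sum_const, Finset.card_range, nsmul_eq_mul]
      rw [hpc]; ring)
    (by
      intro k a ha
      simp only [N, g]
      rw [hrec (k + 1) a ha]
      have h1 : ∑ i ∈ range d, η i ^ (k + 1) = nInt p d f ω ζ k 0 := by
        simp only [hn, add_zero, pow_succ]
      rw [h1]
      simp only [mul_add, Finset.sum_add_distrib, ← Finset.sum_mul, hrow a ha]
      ring)
  obtain ⟨m, rfl⟩ : ∃ m, k = m + 5 := ⟨k - 5, by omega⟩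
  have h := main (m + 3) ν hν
  have hN0 : N 0 ν = 0 := by simp [N, hn0]
  rw [Finset.sum_range_succ, Nat.sub_self, hN0, mul_zero, add_zero, Finset.sum_range_succ',
    Finset.sum_range_succ'] at h
  have hI : ∑ j ∈ Finset.Icc 4 (m + 5 - 1),
      (f : ℂ) * (chainSum d (cycNum p d f ω) 0 θ (j - 3) : ℂ)
        * (nInt p d f ω ζ (m + 5 - j) ν + (f : ℂ) ^ (m + 5 - j))
      = ∑ i ∈ range (m + 1), (f : ℂ) * g (i + 1 + 1) 0 * N (m + 3 - (i + 1 + 1)) ν := by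
    rw [show Finset.Icc 4 (m + 5 - 1) = Finset.Ico 4 (m + 5) by ext; simp; omega,
      Finset.sum_Ico_eq_sum_range, show m + 5 - 4 = m + 1 by omega]
    refine Finset.sum_congr rfl fun i _ => ?_
    simp only [g, N]
    rw [show 4 + i - 3 = i + 1 by omega, show m + 5 - (4 + i) = m + 3 - (i + 1 + 1) by omega]
  rw [hI]
  have hz : (if θ = 0 then (1 : ℂ) else 0) = if 0 = θ then 1 else 0 :=
    if_congr eq_comm rfl rfl
  rw [hz]
  simp only [N, g, chainSum_zero] at h ⊢
  simp only [Nat.sub_zero, zero_add] at h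
  rw [show m + 5 - 2 = m + 3 by omega, show m + 5 - 3 = m + 2 by omega]
  rw [show m + 3 - 1 = m + 2 by omega, show m + 3 + 2 = m + 5 by omega] at h
  rw [h]
  ring
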